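/- Two bicubic polynomials whose Hermite degrees of freedom agree at the two vertices of a common edge agree, together with their full gradients, along that edge: if p and q are bicubic polynomials such that at both vertices v ∈ {(-1,-1), (1,-1)} one has p(v) = q(v), ∂ₓp(v) = ∂ₓq(v), ∂_yp(v) = ∂_yq(v), and ∂ₓ∂_yp(v) = ∂ₓ∂_yq(v), then for all ξ ∈ [-1,1]: p(ξ,-1) = q(ξ,-1), ∂ₓp(ξ,-1) = ∂ₓq(ξ,-1), and ∂_yp(ξ,-1) = ∂_yq(ξ,-1). -/

import Mathlib

/-- A bicubic polynomial: a real function on ℝ² that is polynomial of degree at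
most 3 in each variable separately. -/
def Bicubic (p : ℝ → ℝ → ℝ) : Prop :=
  ∃ a : Fin 4 → Fin 4 → ℝ,
    ∀ x y : ℝ, p x y = ∑ i : Fin 4, ∑ j : Fin 4, a i j * x ^ (i : ℕ) * y ^ (j : ℕ)

/-- Partial derivative in the first (x) variable. -/
noncomputable def pdx (p : ℝ → ℝ → ℝ) (x y : ℝ) : ℝ := deriv (fun t => p t y) x

/-- Partial derivative in the second (y) variable. -/
noncomputable def pdy (p : ℝ → ℝ → ℝ) (x y : ℝ) : ℝ := deriv (fun t => p x t) y

/-- A univariate real polynomial function of degree at most 3. -/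
def IsCubic (f : ℝ → ℝ) : Prop :=
  ∃ c : Fin 4 → ℝ, ∀ x : ℝ, f x = ∑ i : Fin 4, c i * x ^ (i : ℕ)

/-- The derivative of a cubic given by its coefficients. -/
lemma hasDerivAt_cubic (c : Fin 4 → ℝ) (x : ℝ) :
    HasDerivAt (fun t : ℝ => ∑ i : Fin 4, c i * t ^ (i : ℕ))
      (∑ i : Fin 4, c i * ((i : ℕ) * x ^ ((i : ℕ) - 1))) x :=
  HasDerivAt.fun_sum fun i _ => (hasDerivAt_pow (i : ℕ) x).const_mul (c i)

/-- Cubic Hermite interpolation at `-1` and `1` is unisolvent. -/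
lemma IsCubic.eq_of_hermite {f g : ℝ → ℝ} (hf : IsCubic f) (hg : IsCubic g)
    (h : ∀ x ∈ ({-1, 1} : Set ℝ), f x = g x ∧ deriv f x = deriv g x) : f = g := by
  obtain ⟨c, hc⟩ := hf
  obtain ⟨d, hd⟩ := hg
  obtain rfl : f = _ := funext hc
  obtain rfl : g = _ := funext hd
  obtain ⟨h₁, h₂⟩ := h (-1) (by simp)
  obtain ⟨h₃, h₄⟩ := h 1 (by simp)
  rw [(hasDerivAt_cubic c _).deriv, (hasDerivAt_cubic d _).deriv] at h₂ h₄
  norm_num [Fin.sum_univ_four] at h₁ h₂ h₃ h₄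
  have e₀ : c 0 = d 0 := by linarith
  have e₁ : c 1 = d 1 := by linarith
  have e₂ : c 2 = d 2 := by linarith
  have e₃ : c 3 = d 3 := by linarith
  funext x
  simp only [Fin.sum_univ_four, e₀, e₁, e₂, e₃]

/-- The restriction of a bicubic polynomial to a horizontal line is a cubic. -/
lemma Bicubic.isCubic_left {p : ℝ → ℝ → ℝ} (hp : Bicubic p) (y : ℝ) :
    IsCubic fun x => p x y := by
  obtain ⟨a, ha⟩ := hp
  refine ⟨fun i => ∑ j : Fin 4, a i j * y ^ (j : ℕ), fun x => ?_⟩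
  simp only [ha, Finset.sum_mul]
  exact Finset.sum_congr rfl fun i _ => Finset.sum_congr rfl fun j _ => by ring

/-- The normal derivative of a bicubic polynomial along a horizontal line is a cubic. -/
lemma Bicubic.isCubic_pdy {p : ℝ → ℝ → ℝ} (hp : Bicubic p) (y : ℝ) :
    IsCubic fun x => pdy p x y := by
  obtain ⟨a, ha⟩ := hp
  refine ⟨fun i => ∑ j : Fin 4, a i j * ((j : ℕ) * y ^ ((j : ℕ) - 1)), fun x => ?_⟩
  have hderiv : HasDerivAt (fun t => p x t)
      (∑ i : Fin 4, ∑ j : Fin 4, a i j * x ^ (i : ℕ) * ((j : ℕ) * y ^ ((j : ℕ) - 1))) y := by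
    simp only [ha]
    exact HasDerivAt.fun_sum fun i _ => hasDerivAt_cubic (fun j => a i j * x ^ (i : ℕ)) y
  simp only [pdy, hderiv.deriv, Finset.sum_mul]
  exact Finset.sum_congr rfl fun i _ => Finset.sum_congr rfl fun j _ => by ring

/-- Two bicubic polynomials whose Hermite degrees of freedom agree
at the two vertices (-1,-1) and (1,-1) of the bottom edge agree, together with
their full gradients, along that edge. -/
theorem bicubic_edge_gradient_continuity (p q : ℝ → ℝ → ℝ)
    (hp : Bicubic p) (hq : Bicubic q)
    (h : ∀ x ∈ ({-1, 1} : Set ℝ),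
      p x (-1) = q x (-1) ∧ pdx p x (-1) = pdx q x (-1) ∧
      pdy p x (-1) = pdy q x (-1) ∧ pdx (pdy p) x (-1) = pdx (pdy q) x (-1)) :
    ∀ ξ ∈ Set.Icc (-1 : ℝ) 1,
      p ξ (-1) = q ξ (-1) ∧ pdx p ξ (-1) = pdx q ξ (-1) ∧
      pdy p ξ (-1) = pdy q ξ (-1) := by
  have hval : (fun x => p x (-1)) = fun x => q x (-1) :=
    (hp.isCubic_left (-1)).eq_of_hermite (hq.isCubic_left (-1))
      fun x hx => ⟨(h x hx).1, (h x hx).2.1⟩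
  have hnormal : (fun x => pdy p x (-1)) = fun x => pdy q x (-1) :=
    (hp.isCubic_pdy (-1)).eq_of_hermite (hq.isCubic_pdy (-1))
      fun x hx => ⟨(h x hx).2.2.1, (h x hx).2.2.2⟩
  exact fun ξ _ => ⟨congrFun hval ξ, congrArg (fun f => deriv f ξ) hval, congrFun hnormal ξ⟩
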